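/- arXiv:2104.14138 — 6 statements merged into one kernel-verified Lean document; each statement's English description precedes it below -/
import Mathlib

section
/- Let b > 1 be a real number and let r ≥ 0 be a real number. Then the weighted sum of the spectral components of r recovers r; that is, ∑_{i=0}^{∞} b^i · clamp((r − (b^i − 1)/(b − 1))/b^i, 0, 1) = r, where the series converges (in fact all but finitely many terms are zero). -/
/-- Clamp a real number to the interval [0, 1]. -/
noncomputable def clamp (x : ℝ) : ℝ := max 0 (min x 1)

/-- The `i`-th nonnegative spectral component of `r` to base `b`. -/
noncomputable def specPos (b r : ℝ) (i : ℕ) : ℝ :=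
  clamp ((r - (b ^ i - 1) / (b - 1)) / b ^ i)

lemma specPos_term (b r : ℝ) (hb : 1 < b) (i : ℕ) :
    b ^ i * specPos b r i =
      min r ((b ^ (i + 1) - 1) / (b - 1)) - min r ((b ^ i - 1) / (b - 1)) := by
  have hp : 0 < b ^ i := by positivity
  have hb1 : b - 1 ≠ 0 := by linarith
  have hS : (b ^ (i + 1) - 1) / (b - 1) = (b ^ i - 1) / (b - 1) + b ^ i := by
    field_simp
    ring
  rw [hS, specPos, clamp, mul_max_of_nonneg _ _ hp.le, mul_min_of_nonneg _ _ hp.le,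
    mul_div_cancel₀ _ hp.ne', mul_zero, mul_one]
  generalize (b ^ i - 1) / (b - 1) = S
  generalize b ^ i = p at *
  grind

/-- For `b > 1` and `r ≥ 0`, the weighted sum of the nonnegative spectral components of `r`
recovers `r`; all but finitely many terms of the series are zero. -/
theorem spectral_decomposition_nonneg (b r : ℝ) (hb : 1 < b) (hr : 0 ≤ r) :
    {i : ℕ | b ^ i * specPos b r i ≠ 0}.Finite ∧
      HasSum (fun i : ℕ => b ^ i * specPos b r i) r := by
  obtain ⟨N, hN⟩ := pow_unbounded_of_one_lt (r * (b - 1) + 1) hb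
  have hb0 : 0 < b - 1 := by linarith
  have hle : ∀ i, N ≤ i → r ≤ (b ^ i - 1) / (b - 1) := by
    intro i hi
    rw [le_div_iff₀ hb0]
    have := pow_le_pow_right₀ hb.le hi
    linarith
  have hz : ∀ i, N ≤ i → b ^ i * specPos b r i = 0 := by
    intro i hi
    rw [specPos_term b r hb, min_eq_left (hle i hi), min_eq_left (hle (i + 1) (by omega)), sub_self]
  refine ⟨(Set.finite_lt_nat N).subset ?_, ?_⟩
  · intro i hi
    by_contra h
    exact hi (hz i (not_lt.mp h))
  · have hsum : ∑ i ∈ Finset.range N, b ^ i * specPos b r i = r := by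
      simp_rw [specPos_term b r hb]
      rw [Finset.sum_range_sub (fun i => min r ((b ^ i - 1) / (b - 1)))]
      simp [min_eq_left (hle N le_rfl), hr]
    have h := hasSum_sum_of_ne_finset_zero (f := fun i : ℕ => b ^ i * specPos b r i)
      (s := Finset.range N) (L := SummationFilter.unconditional ℕ) (fun i hi => hz i (by simpa using hi))
    rwa [hsum] at h
end

section
/- Let b > 1 be a real number and let r be any real number. Then ∑_{i=0}^{∞} b^i · r_b^i = r, where r_b^i = sign(r) · clamp((|r| − (b^i − 1)/(b − 1))/b^i, 0, 1) and the series converges (all but finitely many terms are zero). -/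
/-- The `i`-th spectral component of the real number `r` to base `b`. -/
noncomputable def spec (b r : ℝ) (i : ℕ) : ℝ :=
  Real.sign r * clamp ((|r| - (b ^ i - 1) / (b - 1)) / b ^ i)

theorem spec_term (b a : ℝ) (hb : 1 < b) (i : ℕ) :
    b ^ i * clamp ((a - (b ^ i - 1) / (b - 1)) / b ^ i) =
      min a ((b ^ (i + 1) - 1) / (b - 1)) - min a ((b ^ i - 1) / (b - 1)) := by
  have hp : 0 < b ^ i := by positivity
  have hb1 : b - 1 ≠ 0 := by linarith
  have hS : (b ^ (i + 1) - 1) / (b - 1) = (b ^ i - 1) / (b - 1) + b ^ i := by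
    field_simp
    ring
  rw [hS]
  generalize (b ^ i - 1) / (b - 1) = S
  unfold clamp
  rw [mul_max_of_nonneg _ _ hp.le, mul_min_of_nonneg _ _ hp.le, mul_div_cancel₀ _ hp.ne']
  generalize b ^ i = p at *
  grind

theorem spec_partial (b a : ℝ) (hb : 1 < b) (ha : 0 ≤ a) (n : ℕ) :
    ∑ i ∈ Finset.range n, b ^ i * clamp ((a - (b ^ i - 1) / (b - 1)) / b ^ i) =
      min a ((b ^ n - 1) / (b - 1)) := by
  rw [Finset.sum_congr rfl (fun i _ => spec_term b a hb i),
    Finset.sum_range_sub (fun i => min a ((b ^ i - 1) / (b - 1)))]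
  simp [ha]

theorem spec_le_geom (b : ℝ) (hb : 1 < b) (n : ℕ) : (n : ℝ) ≤ (b ^ n - 1) / (b - 1) := by
  rw [le_div_iff₀ (by linarith)]
  have := one_add_mul_sub_le_pow (a := b) (by linarith) n
  linarith

/-- For `b > 1` and any real `r`, the weighted sum of the spectral components of `r`
recovers `r`; all but finitely many terms of the series are zero. -/
theorem spectral_decomposition (b r : ℝ) (hb : 1 < b) :
    {i : ℕ | b ^ i * spec b r i ≠ 0}.Finite ∧
      HasSum (fun i : ℕ => b ^ i * spec b r i) r := by
  obtain ⟨N, hN⟩ := exists_nat_ge |r|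
  have hge : ∀ n, N ≤ n → |r| ≤ (b ^ n - 1) / (b - 1) := fun n hn =>
    hN.trans ((Nat.cast_le.mpr hn).trans (spec_le_geom b hb n))
  have hz : ∀ n, N ≤ n → b ^ n * spec b r n = 0 := by
    intro n hn
    unfold spec
    rw [mul_left_comm, spec_term b _ hb, min_eq_left (hge _ hn),
      min_eq_left (hge _ (by omega))]
    simp
  constructor
  · apply (Set.finite_lt_nat N).subset
    intro i hi
    by_contra h
    exact hi (hz i (not_lt.mp h))
  · have hs : ∑ i ∈ Finset.range N, b ^ i * spec b r i = r := by
      unfold spec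
      rw [Finset.sum_congr rfl (fun i _ => mul_left_comm (b ^ i) (Real.sign r) _)]
      rw [← Finset.mul_sum, spec_partial b _ hb (abs_nonneg r), min_eq_left (hge N le_rfl)]
      rcases lt_trichotomy r 0 with h | h | h
      · rw [Real.sign_of_neg h, abs_of_neg h]; ring
      · simp [h]
      · rw [Real.sign_of_pos h, abs_of_pos h]; ring
    have := hasSum_sum_of_ne_finset_zero (f := fun i : ℕ => b ^ i * spec b r i)
      (s := Finset.range N) (L := .unconditional ℕ) (fun i hi => hz i (by simpa using hi))
    rwa [hs] at this
end

section
/- Let b > 1 be a real number, N ∈ ℕ, and let r be a real number with |r| ≤ (b^{N+1} − 1)/(b − 1). Then the finite weighted sum of the first N + 1 spectral components recovers r exactly: ∑_{i=0}^{N} b^i · r_b^i = r. -/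
/-- Partial sums of the weighted clamped components of a nonnegative number. -/
theorem sum_clamp_eq_min (b : ℝ) (hb : 1 < b) (a : ℝ) (ha : 0 ≤ a) (n : ℕ) :
    ∑ i ∈ Finset.range n, b ^ i * clamp ((a - (b ^ i - 1) / (b - 1)) / b ^ i)
      = min a ((b ^ n - 1) / (b - 1)) := by
  induction n with
  | zero => simp [ha]
  | succ n ih =>
    have hp : 0 < b ^ n := by positivity
    have hb1 : b - 1 ≠ 0 := by linarith
    have hs : (b ^ (n + 1) - 1) / (b - 1) = (b ^ n - 1) / (b - 1) + b ^ n := by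
      field_simp
      ring
    rw [Finset.sum_range_succ, ih, hs]
    generalize (b ^ n - 1) / (b - 1) = s
    have hc : b ^ n * clamp ((a - s) / b ^ n) = max 0 (min (a - s) (b ^ n)) := by
      unfold clamp
      rw [mul_max_of_nonneg _ _ hp.le, mul_min_of_nonneg _ _ hp.le, mul_zero, mul_one,
        mul_div_cancel₀ _ hp.ne']
    rw [hc]
    grind

/-- If `|r| ≤ (b^(N+1) - 1)/(b - 1)`, then the finite weighted sum of the first `N + 1`
spectral components recovers `r` exactly. -/
theorem spectral_finite_sum (b : ℝ) (hb : 1 < b) (N : ℕ) (r : ℝ)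
    (hr : |r| ≤ (b ^ (N + 1) - 1) / (b - 1)) :
    ∑ i ∈ Finset.range (N + 1), b ^ i * spec b r i = r := by
  have h := sum_clamp_eq_min b hb |r| (abs_nonneg r) (N + 1)
  rw [min_eq_left hr] at h
  calc ∑ i ∈ Finset.range (N + 1), b ^ i * spec b r i
      = Real.sign r * ∑ i ∈ Finset.range (N + 1),
          b ^ i * clamp ((|r| - (b ^ i - 1) / (b - 1)) / b ^ i) := by
        rw [Finset.mul_sum]
        refine Finset.sum_congr rfl fun i _ => ?_
        unfold spec
        ring
    _ = Real.sign r * |r| := by rw [h]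
    _ = r := by
        rcases lt_trichotomy r 0 with h0 | h0 | h0
        · rw [Real.sign_of_neg h0, abs_of_neg h0]
          ring
        · simp [h0]
        · rw [Real.sign_of_pos h0, abs_of_pos h0, one_mul]
end

section
/- Let b > 1 be a real number, N ∈ ℕ, γ ∈ [0, 1), and let (r_k)_{k∈ℕ} be a sequence of real numbers with |r_k| ≤ (b^{N+1} − 1)/(b − 1) for all k. Then the discounted return decomposes as a weighted sum of spectral returns: ∑_{k=0}^{∞} γ^k · r_k = ∑_{i=0}^{N} b^i · (∑_{k=0}^{∞} γ^k · (r_k)_b^i), where all the series converge absolutely. -/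
theorem clamp_scale (c y : ℝ) (hc : 0 < c) : c * clamp (y / c) = max 0 (min y c) := by
  unfold clamp
  rw [mul_max_of_nonneg _ _ hc.le, mul_min_of_nonneg _ _ hc.le, mul_div_cancel₀ _ hc.ne']
  simp

theorem sum_clamp (b : ℝ) (hb : 1 < b) (x : ℝ) (hx : 0 ≤ x) (n : ℕ) :
    ∑ i ∈ Finset.range n, b ^ i * clamp ((x - (b ^ i - 1) / (b - 1)) / b ^ i)
      = min x ((b ^ n - 1) / (b - 1)) := by
  induction n with
  | zero => simp [hx]
  | succ n ih =>
    have hp : 0 < b ^ n := by positivity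
    have hs : (b ^ (n + 1) - 1) / (b - 1) = (b ^ n - 1) / (b - 1) + b ^ n := by
      have : b - 1 ≠ 0 := by linarith
      field_simp
      ring
    rw [Finset.sum_range_succ, ih, clamp_scale _ _ hp, hs]
    generalize (b ^ n - 1) / (b - 1) = s
    generalize b ^ n = c at hp
    grind

theorem spec_sum (b : ℝ) (hb : 1 < b) (N : ℕ) (x : ℝ)
    (hx : |x| ≤ (b ^ (N + 1) - 1) / (b - 1)) :
    x = ∑ i ∈ Finset.range (N + 1), b ^ i * spec b x i := by
  have h := sum_clamp b hb |x| (abs_nonneg x) (N + 1)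
  rw [min_eq_left hx] at h
  have h2 : Real.sign x * |x| = x := by
    rcases lt_trichotomy x 0 with h | h | h
    · rw [Real.sign_of_neg h, abs_of_neg h]; ring
    · simp [h]
    · rw [Real.sign_of_pos h, abs_of_pos h]; ring
  conv_lhs => rw [← h2, ← h, Finset.mul_sum]
  refine Finset.sum_congr rfl fun i _ => ?_
  unfold spec
  ring

theorem abs_spec_le (b x : ℝ) (i : ℕ) : |spec b x i| ≤ 1 := by
  unfold spec
  generalize (|x| - (b ^ i - 1) / (b - 1)) / b ^ i = y
  have h0 : 0 ≤ clamp y := le_max_left _ _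
  have h1 : clamp y ≤ 1 := max_le zero_le_one (min_le_right _ _)
  rw [abs_le]
  rcases Real.sign_apply_eq x with h | h | h <;> rw [h] <;> constructor <;> linarith

theorem summable_disc (γ : ℝ) (h0 : 0 ≤ γ) (h1 : γ < 1) (f : ℕ → ℝ) (C : ℝ)
    (hf : ∀ k, |f k| ≤ C) : Summable (fun k : ℕ => |γ ^ k * f k|) := by
  refine Summable.of_nonneg_of_le (fun _ => abs_nonneg _) (fun k => ?_)
    ((summable_geometric_of_lt_one h0 h1).mul_right C)
  rw [abs_mul, abs_of_nonneg (pow_nonneg h0 k)]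
  exact mul_le_mul_of_nonneg_left (hf k) (pow_nonneg h0 k)

/-- For a bounded reward sequence, the discounted return decomposes as a weighted sum of
spectral returns, all series converging absolutely. -/
theorem return_decomposition (b : ℝ) (hb : 1 < b) (N : ℕ) (γ : ℝ)
    (hγ0 : 0 ≤ γ) (hγ1 : γ < 1) (r : ℕ → ℝ)
    (hr : ∀ k : ℕ, |r k| ≤ (b ^ (N + 1) - 1) / (b - 1)) :
    Summable (fun k : ℕ => |γ ^ k * r k|) ∧
      (∀ i : ℕ, Summable (fun k : ℕ => |γ ^ k * spec b (r k) i|)) ∧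
      ∑' k : ℕ, γ ^ k * r k =
        ∑ i ∈ Finset.range (N + 1), b ^ i * ∑' k : ℕ, γ ^ k * spec b (r k) i := by
  have hS : ∀ i : ℕ, Summable (fun k : ℕ => |γ ^ k * spec b (r k) i|) := fun i =>
    summable_disc γ hγ0 hγ1 _ 1 (fun k => abs_spec_le b (r k) i)
  refine ⟨summable_disc γ hγ0 hγ1 r _ hr, hS, ?_⟩
  simp_rw [← tsum_mul_left]
  rw [← Summable.tsum_finsetSum (fun i _ => (hS i).of_abs.mul_left _)]
  refine tsum_congr fun k => ?_
  conv_lhs => rw [spec_sum b hb N (r k) (hr k), Finset.mul_sum]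
  refine Finset.sum_congr rfl fun i _ => ?_
  ring
end

section
/- Let ε > 0 and define h : ℝ → ℝ by h(x) = sign(x)(√(|x| + 1) − 1) + εx. Then the inverse function h^{−1} : ℝ → ℝ exists and is Lipschitz continuous with Lipschitz constant 1/ε; equivalently, for all x, y ∈ ℝ, |x − y| ≤ (1/ε)·|h(x) − h(y)|. -/
/-- The target-compression squashing function of Pohlen et al. -/
noncomputable def squash (ε : ℝ) (x : ℝ) : ℝ :=
  Real.sign x * (Real.sqrt (|x| + 1) - 1) + ε * x

theorem squash_eq_aux (ε x : ℝ) :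
    squash ε x = (Real.sqrt (max x 0 + 1) - Real.sqrt (max (-x) 0 + 1)) + ε * x := by
  unfold squash
  rcases lt_trichotomy x 0 with h | h | h
  · rw [Real.sign_of_neg h, abs_of_neg h, max_eq_right h.le, max_eq_left (by linarith)]
    simp
  · subst h; simp
  · rw [Real.sign_of_pos h, abs_of_pos h, max_eq_left h.le, max_eq_right (by linarith)]
    simp

theorem squash_mono_aux (ε : ℝ) {x y : ℝ} (h : x ≤ y) :
    ε * (y - x) ≤ squash ε y - squash ε x := by
  rw [squash_eq_aux, squash_eq_aux]
  have h1 : Real.sqrt (max x 0 + 1) ≤ Real.sqrt (max y 0 + 1) := by gcongr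
  have h2 : Real.sqrt (max (-y) 0 + 1) ≤ Real.sqrt (max (-x) 0 + 1) := by gcongr
  linarith

theorem squash_zero_aux (ε : ℝ) : squash ε 0 = 0 := by simp [squash]

theorem squash_cont_aux (ε : ℝ) : Continuous (squash ε) := by
  rw [funext (squash_eq_aux ε)]
  fun_prop

/-- For `ε > 0`, the squashing function `h(x) = sign(x)(√(|x|+1) - 1) + εx` has an inverse
(it is a bijection of `ℝ`) and the inverse is Lipschitz with constant `1/ε`; equivalently,
`|x - y| ≤ (1/ε)·|h(x) - h(y)|` for all `x, y`. -/
theorem squash_inverse_lipschitz (ε : ℝ) (hε : 0 < ε) :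
    Function.Bijective (squash ε) ∧
      ∀ x y : ℝ, |x - y| ≤ (1 / ε) * |squash ε x - squash ε y| := by
  have key : ∀ x y : ℝ, |x - y| ≤ (1 / ε) * |squash ε x - squash ε y| := by
    intro x y
    rw [one_div, ← div_eq_inv_mul, le_div_iff₀ hε]
    rcases le_total x y with h | h
    · have h1 := squash_mono_aux ε h
      rw [abs_sub_comm x y, abs_sub_comm (squash ε x), abs_of_nonneg (sub_nonneg.2 h)]
      linarith [le_abs_self (squash ε y - squash ε x)]
    · have h1 := squash_mono_aux ε h
      rw [abs_of_nonneg (sub_nonneg.2 h)]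
      linarith [le_abs_self (squash ε x - squash ε y)]
  refine ⟨⟨?_, ?_⟩, key⟩
  · intro x y hxy
    have h := key x y
    rw [hxy, sub_self, abs_zero, mul_zero] at h
    exact sub_eq_zero.1 (abs_nonpos_iff.1 h)
  · refine (squash_cont_aux ε).surjective ?_ ?_
    · refine Filter.tendsto_atTop_mono' _ ?_ (Filter.tendsto_id.const_mul_atTop hε)
      filter_upwards [Filter.eventually_ge_atTop (0 : ℝ)] with x hx
      have h := squash_mono_aux ε hx
      rw [squash_zero_aux] at h
      simpa using h
    · refine Filter.tendsto_atBot_mono' _ ?_ (Filter.tendsto_id.const_mul_atBot hε)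
      filter_upwards [Filter.eventually_le_atBot (0 : ℝ)] with x hx
      have h := squash_mono_aux ε hx
      rw [squash_zero_aux] at h
      simpa using h
end

section
/- Let b > 1 be a real number. The spectral decomposition map r ↦ (r_b^i)_{i∈ℕ} from ℝ to sequences of reals is injective: if two real numbers x and y satisfy x_b^i = y_b^i for every i ∈ ℕ, then x = y. -/
theorem spec_partial_sum (b : ℝ) (hb : 1 < b) (r : ℝ) (n : ℕ) :
    ∑ i ∈ Finset.range n, b ^ i * spec b r i =
      Real.sign r * min |r| ((b ^ n - 1) / (b - 1)) := by
  induction n with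
  | zero => simp
  | succ n ih =>
    have hp : 0 < b ^ n := by positivity
    have hb1 : b - 1 ≠ 0 := by linarith
    have hS : (b ^ (n + 1) - 1) / (b - 1) = (b ^ n - 1) / (b - 1) + b ^ n := by
      field_simp
      ring
    rw [Finset.sum_range_succ, ih, hS]
    unfold spec
    generalize (b ^ n - 1) / (b - 1) = S
    generalize b ^ n = p at hp
    have key : p * clamp ((|r| - S) / p) = max 0 (min (|r| - S) p) := by
      unfold clamp
      rw [mul_max_of_nonneg _ _ hp.le, mul_min_of_nonneg _ _ hp.le, mul_div_cancel₀ _ hp.ne']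
      simp
    have h2 : min |r| (S + p) = min |r| S + max 0 (min (|r| - S) p) := by
      grind
    rw [h2, ← key]
    ring

theorem spectral_decomposition_injective (b : ℝ) (hb : 1 < b) :
    ∀ x y : ℝ, (∀ i : ℕ, spec b x i = spec b y i) → x = y := by
  intro x y h
  obtain ⟨n, hn⟩ := pow_unbounded_of_one_lt ((|x| + |y|) * (b - 1) + 1) hb
  have hS : |x| + |y| ≤ (b ^ n - 1) / (b - 1) := by
    rw [le_div_iff₀ (by linarith)]
    linarith
  have hs : ∀ r : ℝ, Real.sign r * |r| = r := by
    intro r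
    rcases lt_trichotomy r 0 with h | h | h
    · rw [Real.sign_of_neg h, abs_of_neg h]; ring
    · simp [h]
    · rw [Real.sign_of_pos h, abs_of_pos h]; ring
  have hx := spec_partial_sum b hb x n
  have hy := spec_partial_sum b hb y n
  rw [min_eq_left (by linarith [abs_nonneg y]), hs] at hx
  rw [min_eq_left (by linarith [abs_nonneg x]), hs] at hy
  rw [← hx, ← hy]
  simp [h]
end
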